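/- Let Ω₂ = {0,1}^ℕ with the shift map σ. If (x_n) is a sequence of points each of which is generic for a shift-invariant measure of zero entropy, and x ∈ Ω₂ satisfies d̄(x_n, x) → 0 where d̄(y,z) = limsup_N (1/N)|{0 ≤ k < N : y_k ≠ z_k}|, and x is generic for a measure μ, then h_μ(σ) = 0. -/

import Mathlib

open MeasureTheory Filter

/-- Entropy of a finite collection of sets with respect to a measure. -/
noncomputable def partEntropy {X : Type*} [MeasurableSpace X] (μ : Measure X)
    (P : Finset (Set X)) : ℝ :=
  ∑ A ∈ P, Real.negMulLog (μ A).toReal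

/-- `P` is a finite measurable partition of `X` modulo `μ`-null sets. -/
def IsMPartition {X : Type*} [MeasurableSpace X] (μ : Measure X)
    (P : Finset (Set X)) : Prop :=
  (∀ A ∈ P, MeasurableSet A) ∧ μ ((⋃ A ∈ P, A)ᶜ) = 0 ∧
    ∀ A ∈ P, ∀ B ∈ P, A ≠ B → μ (A ∩ B) = 0

open Classical in
/-- The join `P ∨ f⁻¹P ∨ ⋯ ∨ f⁻⁽ⁿ⁻¹⁾P`. -/
noncomputable def joinPart {X : Type*} (f : X → X) (P : Finset (Set X)) (n : ℕ) :
    Finset (Set X) :=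
  (Fintype.piFinset fun _ : Fin n => P).image fun g => ⋂ i : Fin n, f^[(i : ℕ)] ⁻¹' g i

/-- Kolmogorov–Sinai (measure-theoretic) entropy of `f` with respect to `μ`. -/
noncomputable def ksEntropy {X : Type*} [MeasurableSpace X] (f : X → X) (μ : Measure X) : ℝ :=
  ⨆ P : {P : Finset (Set X) // IsMPartition μ P},
    Filter.limsup (fun n => partEntropy μ (joinPart f P.1 n) / n) Filter.atTop

/-- The full shift space `{0,1}^ℕ`. -/
abbrev Omega2 := ℕ → Bool

/-- The shift map on `{0,1}^ℕ`. -/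
def shift : Omega2 → Omega2 := fun y n => y (n + 1)

/-- The `d̄` pseudometric on `{0,1}^ℕ`:
`d̄(y,z) = limsup_N (1/N) |{k < N : y k ≠ z k}|`. -/
noncomputable def seqDbar (y z : Omega2) : ℝ :=
  Filter.limsup
    (fun N => (((Finset.range N).filter fun k => y k ≠ z k).card : ℝ) / N)
    Filter.atTop

/-- `x` is a generic point for `μ`: the empirical measures along the orbit of `x`
converge to `μ` in the weak* topology. -/
def IsGenericFor (f : Omega2 → Omega2) (x : Omega2) (μ : Measure Omega2) : Prop :=
  ∀ g : C(Omega2, ℝ),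
    Filter.Tendsto (fun N : ℕ => (∑ i ∈ Finset.range N, g (f^[i] x)) / N)
      Filter.atTop (nhds (∫ a, g a ∂μ))

/-- Shannon entropy of a random variable with finitely many values. -/
noncomputable def shannonEntropy {X α : Type*} [MeasurableSpace X] [Fintype α]
    (μ : Measure X) (f : X → α) : ℝ :=
  ∑ a, Real.negMulLog (μ.real (f ⁻¹' {a}))

lemma shannonEntropy_nonneg {X α : Type*} [MeasurableSpace X] [Fintype α] (μ : Measure X)
    [IsProbabilityMeasure μ] (f : X → α) : 0 ≤ shannonEntropy μ f :=
  Finset.sum_nonneg fun _ _ => Real.negMulLog_nonneg measureReal_nonneg measureReal_le_one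

lemma negMulLog_sum_le {ι : Type*} (s : Finset ι) (p : ι → ℝ) (hp : ∀ i ∈ s, 0 ≤ p i) :
    Real.negMulLog (∑ i ∈ s, p i) ≤ ∑ i ∈ s, Real.negMulLog (p i) := by
  simp only [Real.negMulLog, neg_mul, Finset.sum_neg_distrib, neg_le_neg_iff, Finset.sum_mul]
  refine Finset.sum_le_sum fun i hi => ?_
  rcases (hp i hi).eq_or_lt with h | h
  · simp [← h]
  · exact mul_le_mul_of_nonneg_left
      (Real.log_le_log h (Finset.single_le_sum hp hi)) h.le

lemma shannonEntropy_le_of_determined {X α β : Type*} [MeasurableSpace X] [Fintype α] [Fintype β]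
    [MeasurableSpace α] [MeasurableSingletonClass α] (μ : Measure X) [IsProbabilityMeasure μ]
    {f : X → α} {g : X → β} (hf : Measurable f)
    (h : ∀ x y, f x = f y → g x = g y) : shannonEntropy μ g ≤ shannonEntropy μ f := by
  classical
  have : Nonempty X := nonempty_of_isProbabilityMeasure μ
  have : Nonempty β := this.map g
  obtain ⟨G, rfl⟩ := (Function.factorsThrough_iff g).1 fun x y => h x y
  unfold shannonEntropy
  rw [← Finset.sum_fiberwise Finset.univ G fun a => Real.negMulLog (μ.real (f ⁻¹' {a}))]
  refine Finset.sum_le_sum fun b _ => ?_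
  have : μ.real (G ∘ f ⁻¹' {b}) = ∑ a with G a = b, μ.real (f ⁻¹' {a}) := by
    rw [← measureReal_biUnion_finset]
    · congr 1
      ext x
      simp
    · intro a _ b _ hab
      refine Set.disjoint_left.2 fun x hx hy => hab ?_
      rw [← hx, ← hy]
    · exact fun a _ => hf (measurableSet_singleton a)
  rw [this]
  exact negMulLog_sum_le _ _ fun _ _ => measureReal_nonneg

section Shannon

variable {X : Type*} [MeasurableSpace X] {α β : Type*} [Fintype α] [Fintype β]
  [MeasurableSpace α] [MeasurableSpace β] [MeasurableSingletonClass α]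
  [MeasurableSingletonClass β] (μ : Measure X) [IsProbabilityMeasure μ]

lemma sum_measureReal_fiber {f : X → α} (hf : Measurable f) {S : Set X} (hS : MeasurableSet S) :
    ∑ a, μ.real (S ∩ f ⁻¹' {a}) = μ.real S := by
  rw [← measureReal_biUnion_finset]
  · congr 1
    ext x
    simp
  · intro a _ b _ hab
    refine Set.disjoint_left.2 fun x hx hy => hab ?_
    rw [← hx.2, ← hy.2]
  · exact fun a _ => hS.inter (hf (measurableSet_singleton a))

lemma shannonEntropy_prodMk_le {f : X → α} {g : X → β} (hf : Measurable f) (hg : Measurable g) :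
    shannonEntropy μ (fun x => (f x, g x)) ≤ shannonEntropy μ f + shannonEntropy μ g := by
  set p : α → ℝ := fun a => μ.real (f ⁻¹' {a}) with hp
  set q : β → ℝ := fun b => μ.real (g ⁻¹' {b}) with hq
  set r : α → β → ℝ := fun a b => μ.real (f ⁻¹' {a} ∩ g ⁻¹' {b}) with hr
  have hrp (a) : ∑ b, r a b = p a := sum_measureReal_fiber μ hg (hf (measurableSet_singleton a))
  have hrq (b) : ∑ a, r a b = q b := by
    change _ = μ.real (g ⁻¹' {b})
    rw [← sum_measureReal_fiber μ hf (hg (measurableSet_singleton b))]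
    simp only [hr, Set.inter_comm]
  have hp1 : ∑ a, p a = 1 := by
    simpa using sum_measureReal_fiber μ hf MeasurableSet.univ
  have hq1 : ∑ a, q a = 1 := by
    simpa using sum_measureReal_fiber μ hg MeasurableSet.univ
  have key (a b) : Real.negMulLog (r a b) ≤
      -(r a b * Real.log (p a)) - r a b * Real.log (q b) + p a * q b - r a b := by
    have hr0 : 0 ≤ r a b := measureReal_nonneg
    have hpa : r a b ≤ p a := measureReal_mono Set.inter_subset_left
    have hqb : r a b ≤ q b := measureReal_mono Set.inter_subset_right
    rcases hr0.eq_or_lt with h | h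
    · rw [← h] at hpa hqb ⊢
      simpa using mul_nonneg hpa hqb
    · have h1 := Real.log_le_sub_one_of_pos (div_pos (mul_pos (h.trans_le hpa) (h.trans_le hqb)) h)
      rw [Real.log_div (mul_pos (h.trans_le hpa) (h.trans_le hqb)).ne' h.ne',
        Real.log_mul (h.trans_le hpa).ne' (h.trans_le hqb).ne'] at h1
      have h2 := mul_le_mul_of_nonneg_left h1 h.le
      rw [mul_sub, mul_sub, mul_add, mul_div_cancel₀ _ h.ne'] at h2
      rw [Real.negMulLog]
      linarith
  have hjoint : shannonEntropy μ (fun x => (f x, g x)) = ∑ a, ∑ b, Real.negMulLog (r a b) := by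
    rw [shannonEntropy, Fintype.sum_prod_type]
    refine Finset.sum_congr rfl fun a _ => Finset.sum_congr rfl fun b _ => ?_
    congr 2
    ext x
    simp
  rw [hjoint]
  refine (Finset.sum_le_sum fun a _ => Finset.sum_le_sum fun b _ => key a b).trans_eq ?_
  simp only [Finset.sum_add_distrib, Finset.sum_sub_distrib, Finset.sum_neg_distrib]
  have e1 : ∑ a, ∑ b, r a b * Real.log (p a) = - shannonEntropy μ f := by
    simp only [← Finset.sum_mul, hrp, shannonEntropy, Real.negMulLog, neg_mul,
      Finset.sum_neg_distrib, neg_neg, hp]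
  have e2 : ∑ a, ∑ b, r a b * Real.log (q b) = - shannonEntropy μ g := by
    rw [Finset.sum_comm]
    simp only [← Finset.sum_mul, hrq, shannonEntropy, Real.negMulLog, neg_mul,
      Finset.sum_neg_distrib, neg_neg, hq]
  have e3 : ∑ a, ∑ b, p a * q b = 1 := by
    simp only [← Finset.mul_sum, hq1, mul_one, hp1]
  have e4 : ∑ a, ∑ b, r a b = 1 := by simp only [hrp, hp1]
  rw [e1, e2, e3, e4]
  ring

lemma shannonEntropy_bool {e : X → Bool} (he : Measurable e) :
    shannonEntropy μ e = Real.binEntropy (μ.real (e ⁻¹' {true})) := by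
  have h : e ⁻¹' {false} = (e ⁻¹' {true})ᶜ := by ext x; simp
  rw [shannonEntropy, Fintype.sum_bool, h, probReal_compl_eq_one_sub (he (measurableSet_singleton _)),
    Real.binEntropy_eq_negMulLog_add_negMulLog_one_sub]

lemma shannonEntropy_pi_le {ι : Type*} [Fintype ι] [DecidableEq ι] {e : ι → X → Bool} (he : ∀ i, Measurable (e i)) :
    shannonEntropy μ (fun x i => e i x) ≤ ∑ i, Real.binEntropy (μ.real (e i ⁻¹' {true})) := by
  classical
  have key (s : Finset ι) : shannonEntropy μ (fun x i => if i ∈ s then e i x else false) ≤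
      ∑ i ∈ s, Real.binEntropy (μ.real (e i ⁻¹' {true})) := by
    induction s using Finset.induction_on with
    | empty =>
      rw [Finset.sum_empty]
      have := shannonEntropy_le_of_determined μ (f := fun _ : X => ()) (β := ι → Bool)
        (g := fun x i => if i ∈ (∅ : Finset ι) then e i x else false) measurable_const
        (fun x y _ => by simp)
      refine this.trans_eq ?_
      simp [shannonEntropy]
    | insert a s ha ih =>
      rw [Finset.sum_insert ha, ← shannonEntropy_bool μ (he a), add_comm]
      have hm : Measurable (fun x i => if i ∈ s then e i x else false) := by
        refine measurable_pi_lambda _ fun i => ?_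
        by_cases hi : i ∈ s
        · simpa [hi] using he i
        · simp [hi]
      refine (shannonEntropy_le_of_determined μ (hm.prodMk (he a)) fun x y hxy => ?_).trans
        ((shannonEntropy_prodMk_le μ hm (he a)).trans (add_le_add_left ih _))
      simp only [Prod.mk.injEq] at hxy
      funext i
      have h1 := congrFun hxy.1 i
      by_cases hi : i = a
      · simp [hi, hxy.2]
      · simpa [hi] using h1
  simpa using key Finset.univ

lemma shannonEntropy_pi_bool_le_add {ι γ : Type*} [Fintype γ] [Fintype ι] [DecidableEq ι]
    {f : X → α} {g : X → γ} {e : ι → X → Bool} (hf : Measurable f) (he : ∀ i, Measurable (e i))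
    (h : ∀ x y, f x = f y → (∀ i, e i x = e i y) → g x = g y) :
    shannonEntropy μ g ≤
      shannonEntropy μ f + ∑ i, Real.binEntropy (μ.real (e i ⁻¹' {true})) := by
  classical
  have hm : Measurable fun x i => e i x := measurable_pi_lambda _ he
  refine (shannonEntropy_le_of_determined μ (hf.prodMk hm) fun x y hxy => ?_).trans
    ((shannonEntropy_prodMk_le μ hf hm).trans (add_le_add_right (shannonEntropy_pi_le μ he) _))
  simp only [Prod.mk.injEq] at hxy
  exact h x y hxy.1 (congrFun hxy.2)

end Shannon

lemma exists_binEntropy_le {ε : ℝ} (hε : 0 < ε) :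
    ∃ η > 0, ∀ p, 0 ≤ p → p ≤ η → Real.binEntropy p ≤ ε := by
  have h := Real.binEntropy_continuous.tendsto 0
  rw [Real.binEntropy_zero] at h
  obtain ⟨η, hη, H⟩ := Metric.eventually_nhds_iff.1 (h.eventually (gt_mem_nhds hε))
  refine ⟨η / 2, half_pos hη, fun p hp hpη => (H ?_).le⟩
  rw [Real.dist_eq, sub_zero, abs_of_nonneg hp]
  linarith

lemma partEntropy_joinPart_le {X : Type*} [MeasurableSpace X] {f : X → X} {μ : Measure X}
    [IsProbabilityMeasure μ] (hf : MeasurePreserving f μ μ) {P : Finset (Set X)}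
    (hP : IsMPartition μ P) (n : ℕ)
    [∀ (A : Set X) (x : X), Decidable (x ∈ A)] :
    partEntropy μ (joinPart f P n) ≤
      shannonEntropy μ fun x (q : Fin n × P) => decide (f^[(q.1 : ℕ)] x ∈ q.2.1) := by
  set Q : X → Fin n × P → Bool := fun x q => decide (f^[(q.1 : ℕ)] x ∈ q.2.1) with hQ
  set w : (Fin n → Set X) → Fin n × P → Bool := fun g q => decide (g q.1 = q.2.1) with hw
  have hnull : ∀ᵐ x ∂μ, ∀ i : Fin n, ∀ A : P, ∀ B : P, A ≠ B →
      f^[(i : ℕ)] x ∉ A.1 ∩ B.1 := by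
    simp only [ae_all_iff]
    intro i A B hAB
    have h0 := hP.2.2 A A.2 B B.2 fun h => hAB (Subtype.ext h)
    exact (hf.iterate i).quasiMeasurePreserving.ae (measure_eq_zero_iff_ae_notMem.1 h0)
  have hcyl : ∀ g ∈ Fintype.piFinset (fun _ : Fin n => P),
      μ.real (⋂ i : Fin n, f^[(i : ℕ)] ⁻¹' g i) = μ.real (Q ⁻¹' {w g}) := by
    intro g hg
    rw [Fintype.mem_piFinset] at hg
    refine measureReal_congr ?_
    filter_upwards [hnull] with x hx
    refine propext ?_
    change x ∈ (⋂ i : Fin n, f^[(i : ℕ)] ⁻¹' g i) ↔ Q x = w g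
    rw [Set.mem_iInter]
    constructor
    · intro h
      funext q
      simp only [hQ, hw, decide_eq_decide]
      refine ⟨fun hq => ?_, fun hq => hq ▸ h q.1⟩
      by_contra hne
      exact hx q.1 ⟨g q.1, hg _⟩ q.2 (fun he => hne (congrArg Subtype.val he)) ⟨h q.1, hq⟩
    · intro h i
      have := congrFun h (i, ⟨g i, hg i⟩)
      simpa [hQ, hw] using this
  have hinj : Set.InjOn w (Fintype.piFinset (fun _ : Fin n => P) : Finset (Fin n → Set X)) := by
    intro g hg g' _ h
    rw [Finset.mem_coe, Fintype.mem_piFinset] at hg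
    funext i
    have := congrFun h (i, ⟨g i, hg i⟩)
    simpa [hw, eq_comm] using this
  have hnn (S : Set X) : 0 ≤ Real.negMulLog (μ.real S) :=
    Real.negMulLog_nonneg measureReal_nonneg measureReal_le_one
  calc partEntropy μ (joinPart f P n)
      ≤ ∑ g ∈ Fintype.piFinset (fun _ : Fin n => P),
          Real.negMulLog (μ.real (⋂ i : Fin n, f^[(i : ℕ)] ⁻¹' g i)) := by
        unfold partEntropy joinPart
        exact Finset.sum_image_le_of_nonneg fun S _ => hnn S
    _ = ∑ v ∈ (Fintype.piFinset (fun _ : Fin n => P)).image w,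
          Real.negMulLog (μ.real (Q ⁻¹' {v})) := by
        rw [Finset.sum_image hinj]
        exact Finset.sum_congr rfl fun g hg => by rw [hcyl g hg]
    _ ≤ shannonEntropy μ Q :=
        Finset.sum_le_sum_of_subset_of_nonneg (Finset.subset_univ _) fun _ _ _ => hnn _

lemma shift_iterate_apply (i : ℕ) (x : Omega2) (j : ℕ) : shift^[i] x j = x (j + i) := by
  induction i generalizing x with
  | zero => rfl
  | succ i ih => rw [Function.iterate_succ_apply, ih, shift]; congr 1

lemma continuous_shift : Continuous shift :=
  continuous_pi fun n => continuous_apply (n + 1)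

/-- Entropy of the distribution of the first `n` coordinates. -/
noncomputable def wordEntropy (μ : Measure Omega2) (n : ℕ) : ℝ :=
  shannonEntropy μ fun (x : Omega2) (j : Fin n) => x j

lemma measurable_word (n : ℕ) : Measurable fun (x : Omega2) (j : Fin n) => x j := by
  fun_prop

section Words

variable (μ : Measure Omega2) [IsProbabilityMeasure μ]

lemma wordEntropy_nonneg (n : ℕ) : 0 ≤ wordEntropy μ n := shannonEntropy_nonneg μ _

lemma wordEntropy_le (n : ℕ) : wordEntropy μ n ≤ n * Real.log 2 := by
  refine (shannonEntropy_pi_le μ (e := fun (j : Fin n) (x : Omega2) => x j)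
    fun j => measurable_pi_apply _).trans ?_
  refine (Finset.sum_le_sum fun _ _ => Real.binEntropy_le_log_two).trans_eq ?_
  simp

lemma wordEntropy_add_le (n k : ℕ) :
    wordEntropy μ (n + k) ≤ wordEntropy μ n + k * Real.log 2 := by
  refine (shannonEntropy_pi_bool_le_add μ (e := fun (j : Fin k) (x : Omega2) => x (n + j))
    (measurable_word n) (fun j => measurable_pi_apply _) fun x y h h' => ?_).trans
    (add_le_add_right ((Finset.sum_le_sum fun _ _ => Real.binEntropy_le_log_two).trans_eq ?_) _)
  · funext j
    rcases lt_or_ge j.1 n with hj | hj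
    · exact congrFun h ⟨j, hj⟩
    · simpa [Nat.add_sub_cancel' hj] using h' ⟨j - n, by omega⟩
  · simp

lemma exists_finite_coordinates_approx {A : Set Omega2} (hA : MeasurableSet A) {η : ℝ}
    (hη : 0 < η) : ∃ (k : ℕ) (t : Set Omega2), MeasurableSet t ∧
      (∀ x y : Omega2, (∀ j < k, x j = y j) → (x ∈ t ↔ y ∈ t)) ∧
      μ.real (symmDiff A t) ≤ η := by
  obtain ⟨t, ht, hlt⟩ := (Measure.MeasureDense.of_generateFrom_isSetAlgebra_finite (μ := μ)
    isSetAlgebra_measurableCylinders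
    generateFrom_measurableCylinders.symm).approx A hA (measure_ne_top _ _) η hη
  obtain ⟨s, S, -, hS⟩ := (mem_measurableCylinders _).1 ht
  refine ⟨s.sup id + 1, t, MeasurableSet.of_mem_measurableCylinders ht, fun x y hxy => ?_, ?_⟩
  · rw [hS, mem_cylinder, mem_cylinder]
    have : s.restrict x = s.restrict y :=
      funext fun j => hxy j (Nat.lt_succ_of_le (Finset.le_sup (f := id) j.2))
    rw [this]
  · exact (ENNReal.toReal_mono ENNReal.ofReal_ne_top hlt.le).trans_eq (ENNReal.toReal_ofReal hη.le)

lemma exists_partEntropy_joinPart_shift_le (hμ : MeasurePreserving shift μ μ)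
    {P : Finset (Set Omega2)} (hP : IsMPartition μ P) {ε : ℝ} (hε : 0 < ε) :
    ∃ k : ℕ, ∀ n : ℕ, partEntropy μ (joinPart shift P n) ≤
      wordEntropy μ n + k * Real.log 2 + n * ε := by
  classical
  have hc : 0 < ε / (P.card + 1) := by positivity
  obtain ⟨η, hη, hbin⟩ := exists_binEntropy_le hc
  choose k t ht hdep happ using fun A : P => exists_finite_coordinates_approx μ (hP.1 A A.2) hη
  refine ⟨Finset.univ.sup k, fun n => ?_⟩
  set e : Fin n × P → Omega2 → Bool :=
    fun q x => decide (shift^[(q.1 : ℕ)] x ∈ symmDiff q.2.1 (t q.2)) with he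
  have hms (A : P) : MeasurableSet (symmDiff A.1 (t A)) := (hP.1 A A.2).symmDiff (ht A)
  have hpre (q) : e q ⁻¹' {true} = shift^[(q.1 : ℕ)] ⁻¹' symmDiff q.2.1 (t q.2) := by
    ext x
    simp only [he, Set.mem_preimage, Set.mem_singleton_iff, decide_eq_true_eq]
  have hem (q) : Measurable (e q) := measurable_to_bool <| by
    rw [hpre]; exact (hμ.iterate _).measurable (hms _)
  refine (partEntropy_joinPart_le hμ hP n).trans ?_
  refine (shannonEntropy_pi_bool_le_add μ (measurable_word (n + Finset.univ.sup k)) hem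
    fun x y hw hxy => ?_).trans (add_le_add (wordEntropy_add_le μ n _) ?_)
  · funext q
    have h1 := hxy q
    have h2 := hdep q.2 (shift^[(q.1 : ℕ)] x) (shift^[(q.1 : ℕ)] y) fun j hj => by
      have hk : k q.2 ≤ Finset.univ.sup k := Finset.le_sup (Finset.mem_univ _)
      rw [shift_iterate_apply, shift_iterate_apply]
      exact congrFun hw ⟨j + q.1, by omega⟩
    simp only [he, decide_eq_decide, Set.mem_symmDiff] at h1
    rw [decide_eq_decide]
    tauto
  · calc ∑ q, Real.binEntropy (μ.real (e q ⁻¹' {true}))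
        ≤ ∑ q : Fin n × P, ε / (P.card + 1) := by
          refine Finset.sum_le_sum fun q _ => hbin _ measureReal_nonneg ?_
          rw [hpre, (hμ.iterate _).measureReal_preimage (hms _).nullMeasurableSet]
          exact happ _
      _ = n * (P.card * (ε / (P.card + 1))) := by simp [mul_assoc]
      _ ≤ n * ε := by
          gcongr
          rw [mul_div_assoc', div_le_iff₀ (by positivity)]
          nlinarith

end Words

/-- The partition of the full shift by the symbol at time zero. -/
noncomputable def symbolPartition : Finset (Set Omega2) :=
  Set.Finite.toFinset (Set.finite_range fun b : Bool => {x : Omega2 | x 0 = b})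

lemma mem_symbolPartition {A : Set Omega2} :
    A ∈ symbolPartition ↔ ∃ b : Bool, {x : Omega2 | x 0 = b} = A := by
  rw [symbolPartition, Set.Finite.mem_toFinset, Set.mem_range]

lemma isMPartition_symbolPartition (μ : Measure Omega2) : IsMPartition μ symbolPartition := by
  refine ⟨?_, ?_, ?_⟩
  · intro A hA
    obtain ⟨b, rfl⟩ := mem_symbolPartition.1 hA
    exact measurable_pi_apply (X := fun _ : ℕ => Bool) 0 (measurableSet_singleton b)
  · convert measure_empty (μ := μ)
    rw [Set.compl_empty_iff, Set.eq_univ_iff_forall]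
    exact fun x => Set.mem_biUnion (mem_symbolPartition.2 ⟨x 0, rfl⟩) rfl
  · intro A hA B hB hAB
    obtain ⟨b, rfl⟩ := mem_symbolPartition.1 hA
    obtain ⟨c, rfl⟩ := mem_symbolPartition.1 hB
    convert measure_empty (μ := μ)
    refine Set.eq_empty_of_forall_notMem fun x hx => hAB ?_
    rw [← hx.1, ← hx.2]

lemma wordEntropy_le_partEntropy (μ : Measure Omega2) [IsProbabilityMeasure μ] (n : ℕ) :
    wordEntropy μ n ≤ partEntropy μ (joinPart shift symbolPartition n) := by
  classical
  set C : (Fin n → Bool) → Set Omega2 := fun w => (fun (x : Omega2) (j : Fin n) => x j) ⁻¹' {w}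
    with hC
  have hinj : Function.Injective C := by
    intro w w' h
    set x : Omega2 := fun j => if h : j < n then w ⟨j, h⟩ else false with hx
    have hxw : (fun j : Fin n => x j) = w := by funext j; simp [hx]
    have : x ∈ C w' := h ▸ (show x ∈ C w from hxw)
    exact hxw.symm.trans this
  have hmem (w) : C w ∈ joinPart shift symbolPartition n := by
    unfold joinPart
    rw [Finset.mem_image]
    refine ⟨fun i => {x : Omega2 | x 0 = w i},
      Fintype.mem_piFinset.2 fun i => mem_symbolPartition.2 ⟨w i, rfl⟩, ?_⟩
    ext x
    simp only [Set.mem_iInter, Set.mem_preimage, Set.mem_ofPred_eq, shift_iterate_apply, zero_add,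
      hC, Set.mem_singleton_iff, funext_iff]
  calc wordEntropy μ n = ∑ S ∈ Finset.univ.image C, Real.negMulLog (μ S).toReal := by
        rw [Finset.sum_image hinj.injOn]; rfl
    _ ≤ _ := Finset.sum_le_sum_of_subset_of_nonneg
        (Finset.image_subset_iff.2 fun w _ => hmem w) fun S _ _ =>
          Real.negMulLog_nonneg measureReal_nonneg measureReal_le_one

section ZeroEntropy

variable {μ : Measure Omega2} [IsProbabilityMeasure μ]

lemma partEntropy_div_nonneg {X : Type*} [MeasurableSpace X] (ν : Measure X)
    [IsProbabilityMeasure ν] (P : Finset (Set X)) (n : ℕ) : 0 ≤ partEntropy ν P / n :=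
  div_nonneg (Finset.sum_nonneg fun _ _ =>
    Real.negMulLog_nonneg measureReal_nonneg measureReal_le_one) n.cast_nonneg

lemma eventually_partEntropy_joinPart_div_le (hμ : MeasurePreserving shift μ μ)
    {P : Finset (Set Omega2)} (hP : IsMPartition μ P) {ε : ℝ} (hε : 0 < ε) :
    ∀ᶠ n : ℕ in atTop,
      partEntropy μ (joinPart shift P n) / n ≤ wordEntropy μ n / n + ε := by
  obtain ⟨k, hk⟩ := exists_partEntropy_joinPart_shift_le μ hμ hP (half_pos hε)
  have hlim : Tendsto (fun n : ℕ => k * Real.log 2 / (n : ℝ)) atTop (nhds 0) :=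
    tendsto_const_div_atTop_nhds_zero_nat _
  filter_upwards [hlim.eventually (gt_mem_nhds (half_pos hε)), eventually_gt_atTop 0] with n hn h0
  have h0' : (0 : ℝ) < n := by exact_mod_cast h0
  calc partEntropy μ (joinPart shift P n) / n
      ≤ (wordEntropy μ n + k * Real.log 2 + n * (ε / 2)) / n := by gcongr; exact hk n
    _ = wordEntropy μ n / n + k * Real.log 2 / n + ε / 2 := by field_simp
    _ ≤ _ := by linarith

lemma wordEntropy_div_le (n : ℕ) : wordEntropy μ n / n ≤ Real.log 2 :=
  div_le_of_le_mul₀ n.cast_nonneg (Real.log_nonneg one_le_two)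
    ((wordEntropy_le μ n).trans_eq (mul_comm _ _))

lemma eventually_partEntropy_joinPart_div_le_log_two_add_one (hμ : MeasurePreserving shift μ μ)
    {P : Finset (Set Omega2)} (hP : IsMPartition μ P) :
    ∀ᶠ n : ℕ in atTop, partEntropy μ (joinPart shift P n) / n ≤ Real.log 2 + 1 :=
  (eventually_partEntropy_joinPart_div_le hμ hP one_pos).mono fun n hn =>
    hn.trans (add_le_add_left (wordEntropy_div_le n) 1)

lemma isCoboundedUnder_partEntropy_joinPart_div (P : Finset (Set Omega2)) :
    IsCoboundedUnder (· ≤ ·) atTop fun n : ℕ => partEntropy μ (joinPart shift P n) / n :=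
  isCoboundedUnder_le_of_le atTop fun n => partEntropy_div_nonneg μ (joinPart shift P n) n

lemma tendsto_wordEntropy_div_of_ksEntropy_eq_zero (hμ : MeasurePreserving shift μ μ)
    (h : ksEntropy shift μ = 0) :
    Tendsto (fun n : ℕ => wordEntropy μ n / n) atTop (nhds 0) := by
  have hbdd : BddAbove (Set.range fun P : {P : Finset (Set Omega2) // IsMPartition μ P} =>
      limsup (fun n : ℕ => partEntropy μ (joinPart shift P.1 n) / n) atTop) := by
    refine ⟨Real.log 2 + 1, ?_⟩
    rintro _ ⟨P, rfl⟩
    exact limsup_le_of_le (isCoboundedUnder_partEntropy_joinPart_div P.1)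
      (eventually_partEntropy_joinPart_div_le_log_two_add_one hμ P.2)
  have hsym := isMPartition_symbolPartition μ
  have hle : limsup (fun n : ℕ => partEntropy μ (joinPart shift symbolPartition n) / n) atTop ≤ 0 :=
    (le_ciSup hbdd ⟨symbolPartition, hsym⟩).trans_eq h
  rw [Metric.tendsto_nhds]
  intro ε hε
  have hbd := eventually_partEntropy_joinPart_div_le_log_two_add_one hμ hsym
  filter_upwards [eventually_lt_of_limsup_lt (hle.trans_lt hε) ⟨_, eventually_map.2 hbd⟩] with n hn
  have h0 : 0 ≤ wordEntropy μ n / n := div_nonneg (wordEntropy_nonneg μ n) n.cast_nonneg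
  rw [Real.dist_eq, sub_zero, abs_of_nonneg h0]
  refine lt_of_le_of_lt ?_ hn
  gcongr
  exact wordEntropy_le_partEntropy μ n

lemma ksEntropy_eq_zero_of_tendsto_wordEntropy_div (hμ : MeasurePreserving shift μ μ)
    (h : Tendsto (fun n : ℕ => wordEntropy μ n / n) atTop (nhds 0)) : ksEntropy shift μ = 0 := by
  refine le_antisymm (Real.iSup_le (fun P => ?_) le_rfl) (Real.iSup_nonneg fun P => ?_)
  · refine le_of_forall_pos_le_add fun ε hε => ?_
    refine limsup_le_of_le (isCoboundedUnder_partEntropy_joinPart_div P.1) ?_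
    filter_upwards [eventually_partEntropy_joinPart_div_le hμ P.2 (half_pos hε),
      h.eventually (gt_mem_nhds (half_pos hε))] with n h1 h2
    linarith
  · exact le_limsup_of_frequently_le
      (Frequently.of_forall fun n => partEntropy_div_nonneg μ (joinPart shift P.1 n) n)
      ⟨_, eventually_map.2 (eventually_partEntropy_joinPart_div_le_log_two_add_one hμ P.2)⟩

end ZeroEntropy

section Empirical

open ProbabilityTheory

lemma uniformOn_range_real (N : ℕ) (S : Set ℕ) [DecidablePred (· ∈ S)] :
    (uniformOn (Finset.range N : Set ℕ)).real S =
      (((Finset.range N).filter (· ∈ S)).card : ℝ) / N := by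
  have h : (Finset.range N : Set ℕ) ∩ S =
      (((Finset.range N).filter (· ∈ S) : Finset ℕ) : Set ℕ) := by
    ext i
    simp
  rw [measureReal_def, ← uniformOn_inter_self (Finset.finite_toSet _), h, uniformOn_apply_finset,
    Finset.inter_eq_right.2 (Finset.filter_subset _ _), Finset.card_range]
  simp

lemma IsGenericFor.tendsto_empirical_wordEntropy {x : Omega2} {μ : Measure Omega2}
    (hx : IsGenericFor shift x μ) (k : ℕ) :
    Tendsto (fun N : ℕ => shannonEntropy (uniformOn (Finset.range N : Set ℕ))
      fun i (j : Fin k) => x (j + i)) atTop (nhds (wordEntropy μ k)) := by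
  classical
  refine tendsto_finsetSum _ fun w _ => (Real.continuous_negMulLog.tendsto _).comp ?_
  have hc : Continuous fun (y : Omega2) (j : Fin k) => y j := by fun_prop
  have hg := hx ⟨_, (continuous_of_discreteTopology
    (f := ({w} : Set (Fin k → Bool)).indicator (1 : (Fin k → Bool) → ℝ))).comp hc⟩
  have hint : ∫ a : Omega2, ({w} : Set (Fin k → Bool)).indicator (1 : (Fin k → Bool) → ℝ)
      (fun j : Fin k => a j) ∂μ = μ.real ((fun (y : Omega2) (j : Fin k) => y j) ⁻¹' {w}) :=
    integral_indicator_one (measurable_word k (measurableSet_singleton w))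
  simp only [ContinuousMap.coe_mk, Function.comp_apply, hint] at hg
  refine hg.congr fun N => ?_
  rw [uniformOn_range_real, Finset.card_filter]
  push_cast
  congr 1
  refine Finset.sum_congr rfl fun i _ => ?_
  simp only [shift_iterate_apply, Set.indicator_apply, Set.mem_singleton_iff, Set.mem_preimage,
    Pi.one_apply]

lemma card_filter_shift_le (p : ℕ → Prop) [DecidablePred p] (N j : ℕ) :
    ((Finset.range N).filter fun i => p (j + i)).card ≤
      ((Finset.range N).filter p).card + j := by
  rw [← Finset.card_image_of_injective _ (add_right_injective j)]
  calc _ ≤ ((Finset.range N).filter p ∪ Finset.Ico N (N + j)).card := by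
        refine Finset.card_le_card fun m hm => ?_
        simp only [Finset.mem_image, Finset.mem_filter, Finset.mem_range] at hm
        obtain ⟨i, ⟨hi, hp⟩, rfl⟩ := hm
        simp only [Finset.mem_union, Finset.mem_filter, Finset.mem_range, Finset.mem_Ico]
        rcases lt_or_ge (j + i) N with h | h
        · exact Or.inl ⟨h, hp⟩
        · exact Or.inr ⟨h, by omega⟩
    _ ≤ _ := (Finset.card_union_le _ _).trans (by simp)

lemma wordEntropy_le_add_of_seqDbar_lt {x z : Omega2} {μ ν : Measure Omega2}
    (hz : IsGenericFor shift z ν) (hx : IsGenericFor shift x μ) {δ : ℝ} (hδ : 0 < δ)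
    (hδ' : 2 * δ ≤ 2⁻¹) (hd : seqDbar z x < δ) (k : ℕ) :
    wordEntropy μ k ≤ wordEntropy ν k + k * Real.binEntropy (2 * δ) := by
  refine le_of_tendsto_of_tendsto (hx.tendsto_empirical_wordEntropy k)
    ((hz.tendsto_empirical_wordEntropy k).add_const _) ?_
  have hbdd : IsBoundedUnder (· ≤ ·) atTop
      fun N : ℕ => (((Finset.range N).filter fun k => z k ≠ x k).card : ℝ) / N := by
    refine isBoundedUnder_of ⟨1, fun N => div_le_one_of_le₀ ?_ N.cast_nonneg⟩
    exact_mod_cast (Finset.card_filter_le _ _).trans_eq (Finset.card_range N)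
  have hlim : Tendsto (fun N : ℕ => (k : ℝ) / N) atTop (nhds 0) :=
    tendsto_const_div_atTop_nhds_zero_nat _
  filter_upwards [eventually_lt_of_limsup_lt hd hbdd, hlim.eventually (gt_mem_nhds hδ),
    eventually_gt_atTop 0] with N h1 h2 hN
  have : IsProbabilityMeasure (uniformOn (Finset.range N : Set ℕ)) :=
    isProbabilityMeasure_uniformOn (Finset.finite_toSet _) ⟨0, by simpa using hN⟩
  refine (shannonEntropy_pi_bool_le_add _
    (e := fun (j : Fin k) (i : ℕ) => decide (z (j + i) ≠ x (j + i)))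
    (f := fun i (j : Fin k) => z (j + i)) (.of_discrete) (fun _ => .of_discrete)
    fun i i' h h' => ?_).trans (add_le_add_right ?_ _)
  · funext j
    have h3 := congrFun h j
    have h4 := h' j
    rw [decide_eq_decide] at h4
    generalize z (j + i) = a at *
    generalize z (j + i') = b at *
    generalize x (j + i) = c at *
    generalize x (j + i') = d at *
    revert a b c d
    decide
  · refine (Finset.sum_le_sum (g := fun _ => Real.binEntropy (2 * δ)) fun j _ => ?_).trans_eq
      (by simp)
    have hfreq : (uniformOn (Finset.range N : Set ℕ)).real
        ((fun i : ℕ => decide (z (j + i) ≠ x (j + i))) ⁻¹' {true}) ≤ 2 * δ := by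
      have hset : (fun i : ℕ => decide (z (j + i) ≠ x (j + i))) ⁻¹' {true} =
          {i | z (j + i) ≠ x (j + i)} := by
        ext i
        simp
      classical
      rw [hset, uniformOn_range_real]
      have hcard := card_filter_shift_le (fun i => z i ≠ x i) N j
      have hN' : (0 : ℝ) < N := by exact_mod_cast hN
      rw [div_lt_iff₀ hN'] at h1 h2
      rw [div_le_iff₀ hN']
      have hj : (j : ℝ) ≤ k := by exact_mod_cast j.2.le
      have hcard' : (((Finset.range N).filter fun i => z (j + i) ≠ x (j + i)).card : ℝ) ≤
          ((Finset.range N).filter fun i => z i ≠ x i).card + j := by exact_mod_cast hcard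
      simp only [Set.mem_ofPred_eq]
      linarith
    exact Real.binEntropy_strictMonoOn.monotoneOn ⟨measureReal_nonneg, hfreq.trans hδ'⟩
      ⟨by positivity, hδ'⟩ hfreq

end Empirical

/-- If each `x n` is generic for a shift-invariant measure of zero entropy,
`d̄(x n, x) → 0`, and `x` is generic for a shift-invariant measure `μ`,
then `h_μ(σ) = 0`. -/
theorem entropy_zero_of_dbar_limit_of_zero_entropy
    (xs : ℕ → Omega2) (μs : ℕ → Measure Omega2)
    (hprob : ∀ n, IsProbabilityMeasure (μs n))
    (hinv : ∀ n, (μs n).map shift = μs n)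
    (hgen : ∀ n, IsGenericFor shift (xs n) (μs n))
    (hzero : ∀ n, ksEntropy shift (μs n) = 0)
    (x : Omega2) (μ : Measure Omega2) (hμprob : IsProbabilityMeasure μ)
    (hμinv : μ.map shift = μ) (hxgen : IsGenericFor shift x μ)
    (hd : Filter.Tendsto (fun n => seqDbar (xs n) x) Filter.atTop (nhds 0)) :
    ksEntropy shift μ = 0 := by
  have hshift := continuous_shift.measurable
  have hzero' (n) : Tendsto (fun k : ℕ => wordEntropy (μs n) k / k) atTop (nhds 0) :=
    tendsto_wordEntropy_div_of_ksEntropy_eq_zero ⟨hshift, hinv n⟩ (hzero n)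
  refine ksEntropy_eq_zero_of_tendsto_wordEntropy_div ⟨hshift, hμinv⟩ ?_
  rw [Metric.tendsto_atTop]
  intro ε hε
  obtain ⟨η, hη, hbin⟩ := exists_binEntropy_le (half_pos hε)
  set δ := min (η / 2) 4⁻¹ with hδ
  have hδ0 : 0 < δ := by positivity
  have hδη : 2 * δ ≤ η := by linarith [min_le_left (η / 2) (4⁻¹ : ℝ)]
  have hδ4 : 2 * δ ≤ 2⁻¹ := by linarith [min_le_right (η / 2) (4⁻¹ : ℝ)]
  obtain ⟨n, hn⟩ := (hd.eventually (gt_mem_nhds hδ0)).exists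
  obtain ⟨K, hK⟩ := eventually_atTop.1 ((hzero' n).eventually (gt_mem_nhds (half_pos hε)))
  refine ⟨max K 1, fun k hk => ?_⟩
  have hk0 : (0 : ℝ) < k := by exact_mod_cast (le_max_right K 1).trans hk
  have h1 := hK k ((le_max_left K 1).trans hk)
  have h2 := wordEntropy_le_add_of_seqDbar_lt (hgen n) hxgen hδ0 hδ4 hn k
  have h3 := hbin (2 * δ) (by positivity) hδη
  rw [Real.dist_eq, sub_zero, abs_of_nonneg (div_nonneg (wordEntropy_nonneg μ k) hk0.le),
    div_lt_iff₀ hk0]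
  rw [div_lt_iff₀ hk0] at h1
  nlinarith
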